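/- Let (X,d) be a Gromov δ-hyperbolic length space, let {u_i} and {v_i} be nonequivalent Gromov sequences in X (representing two distinct points a ≠ b of the Gromov boundary), and let h > 0. Then there exists a sequence of arcs α_i: x_i ⇝ y_i in X, where {x_i} is a Gromov sequence equivalent to {u_i} and {y_i} is a Gromov sequence equivalent to {v_i}, satisfying: (1) each α_i is an h-short arc; (2) for some point s₁ on α₁ one has d(x_i, s₁) → ∞ and d(y_i, s₁) → ∞ as i → ∞; (3) for i ≤ j ≤ m there are length maps f_{ij}: α_i → α_j with f_{ii} = id and f_{im} = f_{jm} ∘ f_{ij}; and (4) d(f_{ij}(u), u) ≤ 12(δ + h) for all points u on α_i and all i ≤ j. -/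

import Mathlib

open Set Filter

/-- The Gromov product `(x|y)_ω = (d(x,ω) + d(y,ω) - d(x,y)) / 2`. -/
noncomputable def gromovProd {X : Type*} [MetricSpace X] (x y ω : X) : ℝ :=
  (dist x ω + dist y ω - dist x y) / 2

theorem dist_le_of_forall_le {X : Type*} [MetricSpace X] {g : ℝ → X} {L : ℝ}
    (h : ∀ s t, s ≤ t → dist (g s) (g t) ≤ L * (t - s)) (s t : ℝ) :
    dist (g s) (g t) ≤ L * |s - t| := by
  rcases le_total s t with hst | hst
  · rw [abs_sub_comm, abs_of_nonneg (sub_nonneg.2 hst)]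
    exact h s t hst
  · rw [dist_comm, abs_of_nonneg (sub_nonneg.2 hst)]
    exact h t s hst

/-- A continuous curve of length at most `V` has a `V`-Lipschitz reparametrization. -/
theorem exists_lipschitz_reparam {X : Type*} [MetricSpace X] {γ : ℝ → X}
    (hγ : ContinuousOn γ (Icc 0 1)) {V : ℝ} (hV : 0 ≤ V)
    (hvar : eVariationOn γ (Icc 0 1) ≤ ENNReal.ofReal V) :
    ∃ f : ℝ → X, (∀ s t, dist (f s) (f t) ≤ V * |s - t|) ∧ (∀ t, f t ∈ γ '' Icc 0 1) ∧
      f 0 = γ 0 ∧ f 1 = γ 1 := by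
  set v : ℝ → ENNReal := fun s => eVariationOn γ (Icc 0 s) with hv
  set S : ℝ → Set ℝ := fun t => {s | s ∈ Icc (0:ℝ) 1 ∧ v s ≤ ENNReal.ofReal (V * t)}
  have vmono : Monotone v := fun a b hab => eVariationOn.mono _ (Icc_subset_Icc_right hab)
  have h0S : ∀ t, (0:ℝ) ∈ S t := fun t => ⟨by simp, by simp [hv]⟩
  have hbdd : ∀ t, BddAbove (S t) := fun t => ⟨1, fun s hs => hs.1.2⟩
  have hmem : ∀ t, sSup (S t) ∈ Icc (0:ℝ) 1 := fun t =>
    ⟨le_csSup (hbdd t) (h0S t), csSup_le ⟨0, h0S t⟩ fun s hs => hs.1.2⟩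
  have key : ∀ t t', t ≤ t' → dist (γ (sSup (S t))) (γ (sSup (S t'))) ≤ V * (t' - t) := by
    intro t t' htt
    have hle : sSup (S t) ≤ sSup (S t') :=
      csSup_le_csSup (hbdd t') ⟨0, h0S t⟩ fun s hs => ⟨hs.1, hs.2.trans
        (ENNReal.ofReal_le_ofReal (mul_le_mul_of_nonneg_left htt hV))⟩
    rcases hle.eq_or_lt with heq | hlt
    · rw [heq, dist_self]
      exact mul_nonneg hV (sub_nonneg.2 htt)
    have hsub : Ioo (sSup (S t)) (sSup (S t')) ⊆ Icc (0:ℝ) 1 := fun x hx =>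
      ⟨(hmem t).1.trans hx.1.le, hx.2.le.trans (hmem t').2⟩
    have aux : ∀ a ∈ Ioo (sSup (S t)) (sSup (S t')), ∀ b ∈ Ioo (sSup (S t)) (sSup (S t')),
        dist (γ a) (γ b) ≤ V * (t' - t) := by
      intro a ha b hb
      wlog hab : a ≤ b generalizing a b
      · rw [dist_comm]
        exact this b hb a ha (le_of_not_ge hab)
      have h1 : ENNReal.ofReal (V * t) ≤ v a := by
        by_contra hcon
        exact absurd (le_csSup (hbdd t) ⟨hsub ha, (not_le.1 hcon).le⟩) (not_le.2 ha.1)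
      have h2 : v b ≤ ENNReal.ofReal (V * t') := by
        obtain ⟨c, hc, hbc⟩ := exists_lt_of_lt_csSup ⟨0, h0S t'⟩ hb.2
        exact (vmono hbc.le).trans hc.2
      have h3 : v a + edist (γ a) (γ b) ≤ v b := by
        have := eVariationOn.Icc_add_Icc γ (s := univ) (hsub ha).1 hab (mem_univ _)
        simp only [univ_inter] at this
        rw [hv]
        simp only
        rw [← this]
        gcongr
        exact eVariationOn.edist_le _ (by simp [hab]) (by simp [hab])
      have h4 : ENNReal.ofReal (V * t) + edist (γ a) (γ b) ≤
          ENNReal.ofReal (V * t) + ENNReal.ofReal (V * (t' - t)) := by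
        refine ((add_le_add_left h1 _).trans h3).trans (h2.trans ?_)
        rw [show V * t' = V * t + V * (t' - t) by ring]
        exact ENNReal.ofReal_add_le
      have h5 := (ENNReal.add_le_add_iff_left ENNReal.ofReal_ne_top).1 h4
      rw [edist_dist] at h5
      exact (ENNReal.ofReal_le_ofReal_iff (mul_nonneg hV (sub_nonneg.2 htt))).1 h5
    have hA := ((hγ _ (hmem t)).mono hsub).tendsto
    have hB := ((hγ _ (hmem t')).mono hsub).tendsto
    have := left_nhdsWithin_Ioo_neBot hlt
    have := right_nhdsWithin_Ioo_neBot hlt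
    have hT := (hA.comp tendsto_fst).dist (hB.comp tendsto_snd)
    refine le_of_tendsto hT ?_
    have := prod_mem_prod
      (self_mem_nhdsWithin (s := Ioo (sSup (S t)) (sSup (S t'))) (a := sSup (S t)))
      (self_mem_nhdsWithin (s := Ioo (sSup (S t)) (sSup (S t'))) (a := sSup (S t')))
    filter_upwards [this] with p hp
    exact aux _ hp.1 _ hp.2
  refine ⟨fun t => γ (sSup (S t)), dist_le_of_forall_le key, fun t => ⟨_, hmem t, rfl⟩, ?_, ?_⟩
  · have hne : (nhdsWithin (sSup (S 0)) (S 0)).NeBot :=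
      mem_closure_iff_nhdsWithin_neBot.1 (csSup_mem_closure ⟨0, h0S 0⟩ (hbdd 0))
    have hA := ((hγ _ (hmem 0)).mono (fun s (hs : s ∈ S 0) => hs.1)).tendsto
    refine tendsto_nhds_unique_of_eventuallyEq hA (tendsto_const_nhds (x := γ 0)) ?_
    filter_upwards [self_mem_nhdsWithin] with s hs
    have h1 : edist (γ s) (γ 0) ≤ v s :=
      eVariationOn.edist_le _ (by simp [hs.1.1]) (by simp [hs.1.1])
    have h2 := h1.trans hs.2
    simpa using h2
  · have h1 : (1:ℝ) ∈ S 1 := ⟨by simp, by simpa [hv] using hvar⟩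
    have : sSup (S 1) = 1 := le_antisymm (hmem 1).2 (le_csSup (hbdd 1) h1)
    simp only [this]

theorem eVariationOn_Icc_le_of_dist_le {X : Type*} [MetricSpace X] {f : ℝ → X} {L : ℝ} (hL : 0 ≤ L)
    (hf : ∀ s t, dist (f s) (f t) ≤ L * |s - t|) {a b : ℝ} (hab : a ≤ b) :
    eVariationOn f (Icc a b) ≤ ENNReal.ofReal (L * (b - a)) := by
  have hlip : LipschitzWith L.toNNReal f := LipschitzWith.of_dist_le_mul fun s t => by
    rw [Real.coe_toNNReal _ hL, Real.dist_eq]; exact hf s t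
  have h1 := (hlip.lipschitzOnWith (s := univ)).comp_eVariationOn_le (g := (id : ℝ → ℝ))
    (s := Icc a b) (mapsTo_univ _ _)
  have h2 : eVariationOn (id : ℝ → ℝ) (Icc a b) ≤ ENNReal.ofReal (b - a) := by
    have := (monotoneOn_id (s := Icc a b)).eVariationOn_eq (left_mem_Icc.2 hab)
      (right_mem_Icc.2 hab)
    rw [inter_self] at this
    exact this.le
  refine h1.trans ((mul_le_mul_right h2 _).trans ?_)
  rw [ENNReal.ofReal_mul hL]
  rfl

/-- Among the Lipschitz curves from `p` to `q` inside a compact set there is one with least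
Lipschitz constant. -/
theorem exists_min_lipschitz {X : Type*} [MetricSpace X] {K : Set X} (hK : IsCompact K)
    {p q : X} {V : ℝ} {f₀ : ℝ → X} (hf₀ : ∀ s t, dist (f₀ s) (f₀ t) ≤ V * |s - t|)
    (hf₀K : ∀ t, f₀ t ∈ K) (h0 : f₀ 0 = p) (h1 : f₀ 1 = q) :
    ∃ (L : ℝ) (f : ℝ → X), L ≤ V ∧ 0 ≤ L ∧ (∀ s t, dist (f s) (f t) ≤ L * |s - t|) ∧
      (∀ t, f t ∈ K) ∧ f 0 = p ∧ f 1 = q ∧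
      ∀ (L' : ℝ) (g : ℝ → X), 0 ≤ L' → (∀ s t, dist (g s) (g t) ≤ L' * |s - t|) →
        (∀ t, g t ∈ K) → g 0 = p → g 1 = q → L ≤ L' := by
  have hV : 0 ≤ V := by simpa using dist_nonneg.trans (hf₀ 0 1)
  set A : Set ((ℝ → X) × ℝ) := (pi univ fun _ => K) ×ˢ Icc 0 V ∩
    {x | (∀ s t, dist (x.1 s) (x.1 t) ≤ x.2 * |s - t|) ∧ x.1 0 = p ∧ x.1 1 = q}
  have hcomp : IsCompact A := by
    refine ((isCompact_univ_pi fun _ => hK).prod isCompact_Icc).inter_right ?_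
    refine IsClosed.inter ?_ (IsClosed.inter ?_ ?_)
    · have heq : {x : (ℝ → X) × ℝ | ∀ s t, dist (x.1 s) (x.1 t) ≤ x.2 * |s - t|} =
          ⋂ s, ⋂ t, {x | dist (x.1 s) (x.1 t) ≤ x.2 * |s - t|} := by
        ext x; simp
      change IsClosed {x : (ℝ → X) × ℝ | ∀ s t, dist (x.1 s) (x.1 t) ≤ x.2 * |s - t|}
      rw [heq]
      refine isClosed_iInter fun s => isClosed_iInter fun t => isClosed_le ?_ ?_ <;> fun_prop
    · exact isClosed_eq (by fun_prop) continuous_const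
    · exact isClosed_eq (by fun_prop) continuous_const
  obtain ⟨⟨f, L⟩, ⟨⟨hfK, hL⟩, hfl, hfp, hfq⟩, hmin⟩ := hcomp.exists_isMinOn
    ⟨(f₀, V), ⟨fun t _ => hf₀K t, right_mem_Icc.2 hV⟩, hf₀, h0, h1⟩ continuous_snd.continuousOn
  refine ⟨L, f, hL.2, hL.1, hfl, fun t => hfK t trivial, hfp, hfq, ?_⟩
  intro L' g hL' hg hgK hg0 hg1
  rcases le_total L' V with h | h
  · exact hmin (a := (g, L')) ⟨⟨fun t _ => hgK t, hL', h⟩, hg, hg0, hg1⟩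
  · exact hL.2.trans h

/-- The image of a rectifiable curve contains a constant speed arc with the same endpoints. -/
theorem exists_constantSpeed_arc {X : Type*} [MetricSpace X] {γ : ℝ → X}
    (hγ : ContinuousOn γ (Icc 0 1)) {V : ℝ} (hV : 0 ≤ V)
    (hvar : eVariationOn γ (Icc 0 1) ≤ ENNReal.ofReal V) (hne : γ 0 ≠ γ 1) :
    ∃ (L : ℝ) (f : ℝ → X), 0 < L ∧ L ≤ V ∧ f 0 = γ 0 ∧ f 1 = γ 1 ∧ InjOn f (Icc 0 1) ∧
      ∀ a b, 0 ≤ a → a ≤ b → b ≤ 1 → eVariationOn f (Icc a b) = ENNReal.ofReal (L * (b - a)) := by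
  obtain ⟨f₀, hf₀, hf₀K, h00, h01⟩ := exists_lipschitz_reparam hγ hV hvar
  obtain ⟨L, f, hLV, hL0, hf, hfK, hf0, hf1, hmin⟩ :=
    exists_min_lipschitz (isCompact_Icc.image_of_continuousOn hγ) hf₀ hf₀K h00 h01
  have hL : 0 < L := by
    refine lt_of_le_of_ne hL0 fun h => hne ?_
    rw [← hf0, ← hf1]
    simpa [← h] using hf 0 1
  refine ⟨L, f, hL, hLV, hf0, hf1, ?_, ?_⟩
  · have aux : ∀ a b, 0 ≤ a → a < b → b ≤ 1 → f a ≠ f b := by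
      intro a b ha hab hb heq
      set m := 1 - (b - a) with hm
      have hm0 : 0 ≤ m := by linarith
      have := hmin (L * m) (fun t => if m * t ≤ a then f (m * t) else f (m * t + (b - a)))
        (by positivity) ?_ ?_ ?_ ?_
      · nlinarith
      · refine dist_le_of_forall_le fun s t hst => ?_
        have hmst : m * s ≤ m * t := mul_le_mul_of_nonneg_left hst hm0
        split_ifs with h1 h2 h2
        · refine (hf _ _).trans (le_of_eq ?_)
          rw [abs_sub_comm, abs_of_nonneg (by linarith)]; ring
        · have e1 := hf (m * s) a
          have e2 := hf b (m * t + (b - a))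
          rw [abs_sub_comm, abs_of_nonneg (by linarith)] at e1
          rw [abs_sub_comm, abs_of_nonneg (by linarith)] at e2
          have e3 := dist_triangle (f (m * s)) (f a) (f (m * t + (b - a)))
          rw [heq] at e1 e3
          linarith
        · linarith
        · refine (hf _ _).trans (le_of_eq ?_)
          rw [abs_sub_comm, abs_of_nonneg (by linarith)]; ring
      · intro t
        split_ifs <;> exact hfK _
      · simp [ha, hf0]
      · split_ifs with h1
        · have hb1 : b = 1 := by linarith
          rw [show m * 1 = a by linarith, heq, hb1, hf1]
        · rw [show m * 1 + (b - a) = 1 by linarith, hf1]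
    intro a ha b hb hab
    rcases lt_trichotomy a b with h | h | h
    · exact absurd hab (aux a b ha.1 h hb.2)
    · exact h
    · exact absurd hab.symm (aux b a hb.1 h ha.2)
  · have hle := fun {a b : ℝ} (hab : a ≤ b) => eVariationOn_Icc_le_of_dist_le hL0 hf hab
    have htot : ENNReal.ofReal L ≤ eVariationOn f (Icc 0 1) := by
      by_contra hcon
      rw [not_le] at hcon
      set W := (eVariationOn f (Icc 0 1)).toReal with hW
      have hWe : ENNReal.ofReal W = eVariationOn f (Icc 0 1) :=
        ENNReal.ofReal_toReal (hcon.trans ENNReal.ofReal_lt_top).ne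
      have hcont : Continuous f := (LipschitzWith.of_dist_le_mul (K := L.toNNReal) fun s t => by
        rw [Real.coe_toNNReal _ hL0, Real.dist_eq]; exact hf s t).continuous
      obtain ⟨g, hg, hgK, hg0, hg1⟩ := exists_lipschitz_reparam hcont.continuousOn
        ENNReal.toReal_nonneg hWe.ge
      have h1 := hmin W g ENNReal.toReal_nonneg hg
        (fun t => by obtain ⟨s, _, hs⟩ := hgK t; rw [← hs]; exact hfK s)
        (hg0.trans hf0) (hg1.trans hf1)
      rw [← hWe] at hcon
      exact absurd (ENNReal.ofReal_le_ofReal h1) (not_le.2 hcon)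
    intro a b ha hab hb
    refine le_antisymm (hle hab) ?_
    have e1 := eVariationOn.Icc_add_Icc f (s := univ) ha hab (mem_univ _)
    have e2 := eVariationOn.Icc_add_Icc f (s := univ) (ha.trans hab) hb (mem_univ _)
    simp only [univ_inter] at e1 e2
    rw [← e2, ← e1] at htot
    have i1 := hle ha
    have i2 := hle hb
    have fin : eVariationOn f (Icc a b) ≠ ⊤ := ne_top_of_le_ne_top ENNReal.ofReal_ne_top (hle hab)
    rw [← ENNReal.ofReal_toReal fin] at htot ⊢
    have h3 := htot.trans (add_le_add (add_le_add_left i1 _) i2)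
    rw [← ENNReal.ofReal_add (mul_nonneg hL0 (by linarith)) ENNReal.toReal_nonneg,
      ← ENNReal.ofReal_add (add_nonneg (mul_nonneg hL0 (by linarith)) ENNReal.toReal_nonneg)
      (mul_nonneg hL0 (by linarith)), ENNReal.ofReal_le_ofReal_iff (by
        have : 0 ≤ (eVariationOn f (Icc a b)).toReal := ENNReal.toReal_nonneg
        nlinarith [mul_nonneg hL0 (sub_nonneg.2 hb), mul_nonneg hL0 ha])] at h3
    refine ENNReal.ofReal_le_ofReal ?_
    linarith

theorem eVariationOn_comp_affine {X : Type*} [MetricSpace X] (f : ℝ → X) {m : ℝ} (hm : 0 < m)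
    (k a b : ℝ) :
    eVariationOn (fun t => f (m * t + k)) (Icc a b) =
      eVariationOn f (Icc (m * a + k) (m * b + k)) := by
  rw [← image_affine_Icc' hm]
  refine eVariationOn.comp_eq_of_monotoneOn f (fun t => m * t + k) fun x _ y _ hxy => ?_
  dsimp only
  gcongr

theorem gromovProd_comm {X : Type*} [MetricSpace X] (x y ω : X) :
    gromovProd x y ω = gromovProd y x ω := by
  simp only [gromovProd, dist_comm x y]
  ring

theorem gromovProd_nonneg {X : Type*} [MetricSpace X] (x y ω : X) : 0 ≤ gromovProd x y ω := by
  have := dist_triangle_right x y ω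
  unfold gromovProd
  linarith

theorem gromovProd_le_dist_left {X : Type*} [MetricSpace X] (x y ω : X) :
    gromovProd x y ω ≤ dist x ω := by
  have := dist_triangle_left y ω x
  unfold gromovProd
  linarith

theorem four_point {X : Type*} [MetricSpace X] {δ : ℝ}
    (hhyp : ∀ x y z ω : X,
      gromovProd x y ω ≥ min (gromovProd x z ω) (gromovProd z y ω) - δ) (x y z w : X) :
    dist x y + dist z w ≤ max (dist x z + dist y w) (dist x w + dist y z) + 2 * δ := by
  have h := hhyp x y z w
  unfold gromovProd at h
  rw [dist_comm z y] at h
  rcases min_cases ((dist x w + dist z w - dist x z) / 2) ((dist z w + dist y w - dist y z) / 2)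
    with ⟨h1, _⟩ | ⟨h1, _⟩
  · have := le_max_left (dist x z + dist y w) (dist x w + dist y z)
    linarith
  · have := le_max_right (dist x z + dist y w) (dist x w + dist y z)
    linarith

theorem le_gromovProd_of_chain {X : Type*} [MetricSpace X] {δ : ℝ} (hδ : 0 ≤ δ)
    (hhyp : ∀ x y z ω : X,
      gromovProd x y ω ≥ min (gromovProd x z ω) (gromovProd z y ω) - δ) {a b c d ω : X} {r : ℝ}
    (hab : r ≤ gromovProd a b ω) (hbc : r ≤ gromovProd b c ω) (hcd : r ≤ gromovProd c d ω) :
    r - 2 * δ ≤ gromovProd a d ω := by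
  have h1 : r - δ ≤ gromovProd a c ω := by
    have := hhyp a c b ω
    have := le_min hab hbc
    linarith
  have h2 := hhyp a d c ω
  have := le_min h1 ((sub_le_self r hδ).trans hcd)
  linarith

/-- A sequence asymptotic to a subsequence of a Gromov sequence is a Gromov sequence equivalent
to the original one. -/
theorem gromov_equivalent_of_subseq {X : Type*} [MetricSpace X] {δ : ℝ} (hδ : 0 ≤ δ)
    (hhyp : ∀ x y z ω : X,
      gromovProd x y ω ≥ min (gromovProd x z ω) (gromovProd z y ω) - δ) {ω : X} {u x : ℕ → X}
    (hu : Tendsto (fun p : ℕ × ℕ => gromovProd (u p.1) (u p.2) ω) atTop atTop)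
    {σ : ℕ → ℕ} (hσ : Tendsto σ atTop atTop)
    (hx : Tendsto (fun i => gromovProd (x i) (u (σ i)) ω) atTop atTop) :
    Tendsto (fun p : ℕ × ℕ => gromovProd (x p.1) (x p.2) ω) atTop atTop ∧
      Tendsto (fun i => gromovProd (x i) (u i) ω) atTop atTop := by
  constructor
  · rw [tendsto_atTop]
    intro r
    have h1 : Tendsto (fun p : ℕ × ℕ => (σ p.1, σ p.2)) atTop atTop := by
      rw [← prod_atTop_atTop_eq]
      exact hσ.prodMap hσ
    have h2 : Tendsto (Prod.fst : ℕ × ℕ → ℕ) atTop atTop := by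
      rw [← prod_atTop_atTop_eq]; exact tendsto_fst
    have h3 : Tendsto (Prod.snd : ℕ × ℕ → ℕ) atTop atTop := by
      rw [← prod_atTop_atTop_eq]; exact tendsto_snd
    filter_upwards [(hu.comp h1).eventually_ge_atTop (r + 2 * δ),
      (hx.comp h2).eventually_ge_atTop (r + 2 * δ),
      (hx.comp h3).eventually_ge_atTop (r + 2 * δ)] with p e1 e2 e3
    have := le_gromovProd_of_chain hδ hhyp e2 e1 (by rw [gromovProd_comm]; exact e3)
    linarith
  · rw [tendsto_atTop]
    intro r
    have h1 : Tendsto (fun i => (σ i, i)) atTop atTop := by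
      rw [← prod_atTop_atTop_eq]
      exact hσ.prodMk tendsto_id
    filter_upwards [(hu.comp h1).eventually_ge_atTop (r + δ),
      hx.eventually_ge_atTop (r + δ)] with i e1 e2
    have h2 := hhyp (x i) (u i) (u (σ i)) ω
    have := le_min e2 e1
    simp only [Function.comp_apply] at this
    linarith

/-- In a hyperbolic length space, the part near `ω` of a short arc from `p` to `q`, parametrized
by arclength so that the parameter `0` corresponds to the point nearest to `ω`. -/
theorem exists_centered_arc {X : Type*} [MetricSpace X] {δ : ℝ}
    (hhyp : ∀ x y z ω : X,
      gromovProd x y ω ≥ min (gromovProd x z ω) (gromovProd z y ω) - δ)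
    (hlength : ∀ p q : X, ∀ ε : ℝ, 0 < ε → ∃ γ : ℝ → X, ContinuousOn γ (Icc 0 1) ∧
      γ 0 = p ∧ γ 1 = q ∧ eVariationOn γ (Icc 0 1) ≤ ENNReal.ofReal (dist p q + ε))
    {h : ℝ} (hh : 0 < h) {p q ω : X} {T : ℝ} (hT : 0 < T)
    (hp : T ≤ dist p ω - gromovProd p q ω) (hq : T ≤ dist q ω - gromovProd p q ω) :
    ∃ β : ℝ → X,
      (∀ a b, -T ≤ a → a ≤ b → b ≤ T → eVariationOn β (Icc a b) = ENNReal.ofReal (b - a)) ∧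
      InjOn β (Icc (-T) T) ∧ 2 * T ≤ dist (β (-T)) (β T) + h ∧
      ∀ t ∈ Icc (-T) T, dist (β t) p ≤ dist p ω - gromovProd p q ω + t + h ∧
        dist (β t) q ≤ dist q ω - gromovProd p q ω - t + h ∧
        dist (β t) ω ≤ |t| + gromovProd p q ω + 2 * δ + h := by
  have hpq : dist p q = dist p ω - gromovProd p q ω + (dist q ω - gromovProd p q ω) := by
    unfold gromovProd; ring
  have hne : p ≠ q := dist_pos.1 (by linarith)
  obtain ⟨γ, hγ, hγ0, hγ1, hvar⟩ := hlength p q h hh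
  obtain ⟨L, f, hL, hLV, hf0, hf1, hinj, hf⟩ := exists_constantSpeed_arc hγ
    (add_nonneg dist_nonneg hh.le) hvar (by rwa [hγ0, hγ1])
  rw [hγ0] at hf0
  rw [hγ1] at hf1
  have hdist : ∀ a b, 0 ≤ a → a ≤ b → b ≤ 1 → dist (f a) (f b) ≤ L * (b - a) := by
    intro a b ha hab hb
    have h1 := eVariationOn.edist_le f (left_mem_Icc.2 hab) (right_mem_Icc.2 hab)
    rw [hf a b ha hab hb, edist_dist] at h1
    exact (ENNReal.ofReal_le_ofReal_iff (mul_nonneg hL.le (sub_nonneg.2 hab))).1 h1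
  have hpqL : dist p q ≤ L := by
    have := hdist 0 1 le_rfl zero_le_one le_rfl
    rw [hf0, hf1] at this
    linarith
  set e := gromovProd p q ω with he
  set c := dist p ω - e with hc
  have hpar : ∀ t, L * (L⁻¹ * t + L⁻¹ * c) = t + c := fun t => by field_simp
  have hpar0 : ∀ t, -T ≤ t → 0 ≤ L⁻¹ * t + L⁻¹ * c := fun t ht => by
    rw [← mul_add]; exact mul_nonneg (inv_nonneg.2 hL.le) (by linarith)
  have hpar1 : ∀ t, t ≤ T → L⁻¹ * t + L⁻¹ * c ≤ 1 := fun t ht => by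
    refine le_of_mul_le_mul_left ?_ hL
    rw [hpar]; linarith
  have hmono : ∀ {s t}, s ≤ t → L⁻¹ * s + L⁻¹ * c ≤ L⁻¹ * t + L⁻¹ * c := fun hst => by
    have := inv_pos.2 hL
    gcongr
  have hβp : ∀ t ∈ Icc (-T) T, dist (f (L⁻¹ * t + L⁻¹ * c)) p ≤ c + t := fun t ht => by
    have := hdist 0 _ le_rfl (hpar0 t ht.1) (hpar1 t ht.2)
    rw [hf0, sub_zero, hpar] at this
    rw [dist_comm]; linarith
  have hβq : ∀ t ∈ Icc (-T) T, dist (f (L⁻¹ * t + L⁻¹ * c)) q ≤ L - (c + t) := fun t ht => by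
    have := hdist _ 1 (hpar0 t ht.1) (hpar1 t ht.2) le_rfl
    rw [hf1, mul_sub L, hpar] at this
    linarith
  refine ⟨fun t => f (L⁻¹ * t + L⁻¹ * c), ?_, ?_, ?_, ?_⟩
  · intro a b ha hab hb
    rw [eVariationOn_comp_affine f (inv_pos.2 hL), hf _ _ (hpar0 a ha) (hmono hab) (hpar1 b hb),
      mul_sub L, hpar, hpar]
    congr 1
    ring
  · intro s hs t ht hst
    have := hinj ⟨hpar0 s hs.1, hpar1 s hs.2⟩ ⟨hpar0 t ht.1, hpar1 t ht.2⟩ hst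
    have h2 := congrArg (L * ·) this
    simp only [hpar] at h2
    linarith
  · have h1 := hβp (-T) ⟨le_rfl, by linarith⟩
    have h2 := hβq T ⟨by linarith, le_rfl⟩
    have h3 := dist_triangle4 p (f (L⁻¹ * -T + L⁻¹ * c)) (f (L⁻¹ * T + L⁻¹ * c)) q
    rw [dist_comm] at h1
    linarith
  · intro t ht
    refine ⟨by have := hβp t ht; linarith, by have := hβq t ht; linarith, ?_⟩
    have h0 : (0:ℝ) ∈ Icc (-T) T := ⟨by linarith, hT.le⟩
    have h1 := hβp 0 h0
    have h2 := hβq 0 h0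
    have h3 := four_point hhyp (f (L⁻¹ * 0 + L⁻¹ * c)) ω p q
    have h4 : dist (f (L⁻¹ * t + L⁻¹ * c)) (f (L⁻¹ * 0 + L⁻¹ * c)) ≤ |t| := by
      rcases le_total 0 t with h | h
      · rw [dist_comm]
        have := hdist _ _ (hpar0 0 h0.1) (hmono h) (hpar1 t ht.2)
        rw [mul_sub L, hpar, hpar] at this
        rw [abs_of_nonneg h]; linarith
      · have := hdist _ _ (hpar0 t ht.1) (hmono h) (hpar1 0 h0.2)
        rw [mul_sub L, hpar, hpar] at this
        rw [abs_of_nonpos h]; linarith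
    have h5 := dist_triangle (f (L⁻¹ * t + L⁻¹ * c)) (f (L⁻¹ * 0 + L⁻¹ * c)) ω
    have h6 : max (dist (f (L⁻¹ * 0 + L⁻¹ * c)) p + dist ω q)
        (dist (f (L⁻¹ * 0 + L⁻¹ * c)) q + dist ω p) ≤ c + dist q ω + h := by
      rw [dist_comm ω q, dist_comm ω p]
      exact max_le (by linarith) (by linarith)
    linarith

/-- Points at the same signed distance `t` from the centers of two short arcs are close to each
other, provided the ends `w`, `w'` of the arcs fellow-travel beyond that distance. -/
theorem dist_le_of_fellow_travel {X : Type*} [MetricSpace X] {δ : ℝ}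
    (hhyp : ∀ x y z ω : X,
      gromovProd x y ω ≥ min (gromovProd x z ω) (gromovProd z y ω) - δ)
    {q r w w' ω : X} {e e' t h : ℝ} (hqω : dist q ω ≤ t + e + 2 * δ + h)
    (hqw : dist q w ≤ dist w ω - e - t + h) (hrω : dist r ω ≤ t + e' + 2 * δ + h)
    (hrw : dist r w' ≤ dist w' ω - e' - t + h) (he : |e - e'| ≤ 2 * δ)
    (hG : t + e + δ ≤ gromovProd w w' ω) :
    dist q r ≤ 8 * δ + 2 * h := by
  obtain ⟨he1, he2⟩ := abs_le.1 he
  unfold gromovProd at hG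
  have h1 := four_point hhyp q w' ω w
  have h2 : max (dist q ω + dist w' w) (dist q w + dist w' ω) ≤
      dist w ω + dist w' ω - e - t + h := by
    rw [dist_comm w' w]
    exact max_le (by linarith) (by linarith)
  rw [dist_comm ω w] at h1
  have h3 := four_point hhyp q r ω w'
  have h4 : max (dist q ω + dist r w') (dist q w' + dist r ω) ≤
      dist w' ω + 6 * δ + 2 * h := by
    exact max_le (by linarith) (by linarith)
  rw [dist_comm ω w'] at h3
  linarith

theorem exists_forall_ge_of_tendsto_prod {f : ℕ × ℕ → ℝ} (hf : Tendsto f atTop atTop) (r : ℝ) :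
    ∃ N, ∀ k ≥ N, ∀ l ≥ N, r ≤ f (k, l) := by
  obtain ⟨⟨a, b⟩, hab⟩ := eventually_atTop.1 (hf.eventually_ge_atTop r)
  exact ⟨max a b, fun k hk l hl =>
    hab (k, l) ⟨(le_max_left a b).trans hk, (le_max_right a b).trans hl⟩⟩

/-- Gromov products of nonequivalent Gromov sequences are eventually bounded and eventually
constant up to an error `2 * δ`. -/
theorem eventually_gromovProd_almost_constant {X : Type*} [MetricSpace X] {δ : ℝ} (hδ : 0 ≤ δ)
    (hhyp : ∀ x y z ω : X,
      gromovProd x y ω ≥ min (gromovProd x z ω) (gromovProd z y ω) - δ) {ω : X} {u v : ℕ → X}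
    (hu : Tendsto (fun p : ℕ × ℕ => gromovProd (u p.1) (u p.2) ω) atTop atTop)
    (hv : Tendsto (fun p : ℕ × ℕ => gromovProd (v p.1) (v p.2) ω) atTop atTop)
    (huv : ¬ Tendsto (fun i => gromovProd (u i) (v i) ω) atTop atTop) :
    ∃ (M : ℝ) (N : ℕ), (∀ k ≥ N, gromovProd (u k) (v k) ω ≤ M) ∧
      ∀ k ≥ N, ∀ l ≥ N, |gromovProd (u k) (v k) ω - gromovProd (u l) (v l) ω| ≤ 2 * δ := by
  simp only [tendsto_atTop, not_forall, not_eventually, not_le] at huv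
  obtain ⟨M, hM⟩ := huv
  obtain ⟨N₁, hN₁⟩ := exists_forall_ge_of_tendsto_prod hu (M + 2 * δ)
  obtain ⟨N₂, hN₂⟩ := exists_forall_ge_of_tendsto_prod hv (M + 2 * δ)
  obtain ⟨i, hi, hiM⟩ := frequently_atTop.1 hM (max N₁ N₂)
  have hi₁ := (le_max_left N₁ N₂).trans hi
  have hi₂ := (le_max_right N₁ N₂).trans hi
  have hle : ∀ k ≥ max N₁ N₂, gromovProd (u k) (v k) ω ≤ M + 2 * δ := by
    intro k hk
    by_contra hcon
    have := le_gromovProd_of_chain hδ hhyp (hN₁ i hi₁ k ((le_max_left _ _).trans hk))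
      (not_le.1 hcon).le (hN₂ k ((le_max_right _ _).trans hk) i hi₂)
    linarith
  refine ⟨M + 2 * δ, max N₁ N₂, hle, ?_⟩
  have key : ∀ k ≥ max N₁ N₂, ∀ l ≥ max N₁ N₂,
      gromovProd (u l) (v l) ω - 2 * δ ≤ gromovProd (u k) (v k) ω := fun k hk l hl =>
    le_gromovProd_of_chain hδ hhyp
      ((hle l hl).trans (hN₁ k ((le_max_left _ _).trans hk) l ((le_max_left _ _).trans hl))) le_rfl
      ((hle l hl).trans (hN₂ l ((le_max_right _ _).trans hl) k ((le_max_right _ _).trans hk)))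
  intro k hk l hl
  rw [abs_le]
  constructor
  · linarith [key k hk l hl]
  · linarith [key l hl k hk]

theorem tendsto_dist_atTop_of_gromovProd {X : Type*} [MetricSpace X] {x z : ℕ → X} {ω : X}
    (hx : Tendsto (fun i => gromovProd (x i) (z i) ω) atTop atTop) (s : X) :
    Tendsto (fun i => dist (x i) s) atTop atTop := by
  refine tendsto_atTop_mono (fun i => ?_) (tendsto_atTop_add_const_right _ (-dist s ω) hx)
  have h1 := gromovProd_le_dist_left (x i) (z i) ω
  have h2 := dist_triangle (x i) s ω
  linarith

/-- The coordinate change between the arclength parametrizations of `[-(i+1), i+1]` and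
`[-(j+1), j+1]` by `[0, 1]`, preserving the signed distance to the midpoint. -/
noncomputable def centeredShift (i j : ℕ) (s : ℝ) : ℝ :=
  ((2 * s - 1) * (i + 1) / (j + 1) + 1) / 2

theorem centeredShift_coord (i j : ℕ) (s : ℝ) :
    (2 * centeredShift i j s - 1) * (j + 1) = (2 * s - 1) * (i + 1) := by
  have : (j : ℝ) + 1 ≠ 0 := by positivity
  unfold centeredShift
  field_simp
  ring

theorem eq_centeredShift_iff {i j : ℕ} {s r : ℝ} :
    r = centeredShift i j s ↔ (2 * r - 1) * (j + 1) = (2 * s - 1) * (i + 1) := by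
  constructor
  · rintro rfl
    exact centeredShift_coord i j s
  · intro h
    rw [← centeredShift_coord i j s] at h
    have := mul_right_cancel₀ (by positivity) h
    linarith

theorem coord_mem {i : ℕ} {s : ℝ} (hs : s ∈ Icc (0 : ℝ) 1) :
    (2 * s - 1) * (i + 1) ∈ Icc (-((i : ℝ) + 1)) (i + 1) := by
  have : (0 : ℝ) ≤ i := i.cast_nonneg
  constructor <;> nlinarith [hs.1, hs.2]

theorem centeredShift_mono (i j : ℕ) : Monotone (centeredShift i j) := fun s t hst => by
  unfold centeredShift
  gcongr

theorem centeredShift_mem {i j : ℕ} (hij : i ≤ j) {s : ℝ} (hs : s ∈ Icc (0 : ℝ) 1) :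
    centeredShift i j s ∈ Icc (0 : ℝ) 1 := by
  have hij' : (i : ℝ) ≤ j := by exact_mod_cast hij
  have h1 := coord_mem (i := i) hs
  rw [← centeredShift_coord i j s] at h1
  have : (0 : ℝ) < (j : ℝ) + 1 := by positivity
  constructor
  · by_contra hcon
    nlinarith [h1.1, not_le.1 hcon]
  · by_contra hcon
    nlinarith [h1.2, not_le.1 hcon]

/-- Theorem 1.3: Let `X` be a Gromov `δ`-hyperbolic length space, let
`{u_i}` and `{v_i}` be nonequivalent Gromov sequences (representing distinct boundary
points `a ≠ b`), and let `h > 0`. Then there is a sequence of arcs `α_i : x_i ⇝ y_i`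
(parametrized on `[0,1]`), where `{x_i}` is a Gromov sequence equivalent to `{u_i}` and
`{y_i}` is a Gromov sequence equivalent to `{v_i}`, such that:
(1) each `α_i` is `h`-short;
(2) for some point `s₁ = α₁ t₁` on `α₁`, `d(x_i, s₁) → ∞` and `d(y_i, s₁) → ∞`;
(3) for `i ≤ j ≤ m` there are length maps `f_{ij} : α_i → α_j` (given at parameter level
by monotone maps `φ i j` of `[0,1]` with `ℓ(α_j|[φ u, φ v]) = ℓ(α_i|[u,v])`) with
`f_{ii} = id` and `f_{im} = f_{jm} ∘ f_{ij}`;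
(4) `d(f_{ij}(u), u) ≤ 12(δ + h)` for all `u` on `α_i` and `i ≤ j`. -/
theorem exists_shortArcs_between_boundary_points {X : Type*} [MetricSpace X]
    (δ : ℝ) (hδ : 0 ≤ δ)
    (hhyp : ∀ x y z ω : X,
      gromovProd x y ω ≥ min (gromovProd x z ω) (gromovProd z y ω) - δ)
    -- `X` is a length space: any two points are joined by curves of length
    -- arbitrarily close to their distance.
    (hlength : ∀ p q : X, ∀ ε : ℝ, 0 < ε → ∃ γ : ℝ → X, ContinuousOn γ (Icc 0 1) ∧
      γ 0 = p ∧ γ 1 = q ∧ eVariationOn γ (Icc 0 1) ≤ ENNReal.ofReal (dist p q + ε))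
    (ω : X) (u v : ℕ → X)
    -- `{u_i}` and `{v_i}` are Gromov sequences
    (hu : Tendsto (fun p : ℕ × ℕ => gromovProd (u p.1) (u p.2) ω) atTop atTop)
    (hv : Tendsto (fun p : ℕ × ℕ => gromovProd (v p.1) (v p.2) ω) atTop atTop)
    -- which are nonequivalent (they represent distinct boundary points `a ≠ b`)
    (huv : ¬ Tendsto (fun i => gromovProd (u i) (v i) ω) atTop atTop)
    (h : ℝ) (hh : 0 < h) :
    ∃ (α : ℕ → ℝ → X) (x y : ℕ → X) (φ : ℕ → ℕ → ℝ → ℝ),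
      -- each `α i` is an arc from `x_i` to `y_i`
      (∀ i, ContinuousOn (α i) (Icc 0 1) ∧ InjOn (α i) (Icc 0 1) ∧
        α i 0 = x i ∧ α i 1 = y i) ∧
      -- `{x_i}` is a Gromov sequence equivalent to `{u_i}`
      Tendsto (fun p : ℕ × ℕ => gromovProd (x p.1) (x p.2) ω) atTop atTop ∧
      Tendsto (fun i => gromovProd (x i) (u i) ω) atTop atTop ∧
      -- `{y_i}` is a Gromov sequence equivalent to `{v_i}`
      Tendsto (fun p : ℕ × ℕ => gromovProd (y p.1) (y p.2) ω) atTop atTop ∧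
      Tendsto (fun i => gromovProd (y i) (v i) ω) atTop atTop ∧
      -- (1) each `α i` is `h`-short
      (∀ i, eVariationOn (α i) (Icc 0 1) ≤ ENNReal.ofReal (dist (x i) (y i) + h)) ∧
      -- (2) some point `s₁ = α 0 t₁` on the first arc satisfies
      --     `d(x_i, s₁) → ∞` and `d(y_i, s₁) → ∞`
      (∃ t₁ ∈ Icc (0:ℝ) 1,
        Tendsto (fun i => dist (x i) (α 0 t₁)) atTop atTop ∧
        Tendsto (fun i => dist (y i) (α 0 t₁)) atTop atTop) ∧
      -- (3) for `i ≤ j`, `φ i j` induces a length map `f_{ij} : α_i → α_j`,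
      (∀ i j, i ≤ j →
        MapsTo (φ i j) (Icc 0 1) (Icc 0 1) ∧ MonotoneOn (φ i j) (Icc 0 1) ∧
        (∀ a b : ℝ, a ∈ Icc (0:ℝ) 1 → b ∈ Icc (0:ℝ) 1 → a ≤ b →
          eVariationOn (α j) (Icc (φ i j a) (φ i j b)) = eVariationOn (α i) (Icc a b))) ∧
      -- with `f_{ii} = id` and `f_{im} = f_{jm} ∘ f_{ij}` for `i ≤ j ≤ m`
      (∀ i, ∀ s ∈ Icc (0:ℝ) 1, φ i i s = s) ∧
      (∀ i j m, i ≤ j → j ≤ m → ∀ s ∈ Icc (0:ℝ) 1, φ i m s = φ j m (φ i j s)) ∧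
      -- (4) `d(f_{ij}(u), u) ≤ 12(δ + h)` for all `u` on `α_i` and `i ≤ j`
      (∀ i j, i ≤ j → ∀ s ∈ Icc (0:ℝ) 1,
        dist (α j (φ i j s)) (α i s) ≤ 12 * (δ + h)) := by
  obtain ⟨M, N, hM, he⟩ := eventually_gromovProd_almost_constant hδ hhyp hu hv huv
  obtain ⟨σ, hσ, hσN⟩ := extraction_forall_of_eventually'
    (P := fun n m => N ≤ m ∧ (∀ k ≥ m, ∀ l ≥ m, (n + 1 + M + δ : ℝ) ≤ gromovProd (u k) (u l) ω) ∧
      ∀ k ≥ m, ∀ l ≥ m, (n + 1 + M + δ : ℝ) ≤ gromovProd (v k) (v l) ω) fun n => by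
      obtain ⟨N₁, hN₁⟩ := exists_forall_ge_of_tendsto_prod hu (n + 1 + M + δ)
      obtain ⟨N₂, hN₂⟩ := exists_forall_ge_of_tendsto_prod hv (n + 1 + M + δ)
      refine ⟨max N (max N₁ N₂), fun m hm => ?_⟩
      simp only [ge_iff_le, max_le_iff] at hm
      exact ⟨hm.1, fun k hk l hl => hN₁ k (hm.2.1.trans hk) l (hm.2.1.trans hl),
        fun k hk l hl => hN₂ k (hm.2.2.trans hk) l (hm.2.2.trans hl)⟩
  have hT : ∀ i : ℕ, (0 : ℝ) < (i : ℝ) + 1 := fun i => by positivity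
  have hσM : ∀ i, gromovProd (u (σ i)) (v (σ i)) ω ≤ M := fun i => hM _ (hσN i).1
  have hGu : ∀ i j : ℕ, i ≤ j → (i + 1 + M + δ : ℝ) ≤ gromovProd (u (σ i)) (u (σ j)) ω :=
    fun i j hij => (hσN i).2.1 _ le_rfl _ (hσ.monotone hij)
  have hGv : ∀ i j : ℕ, i ≤ j → (i + 1 + M + δ : ℝ) ≤ gromovProd (v (σ i)) (v (σ j)) ω :=
    fun i j hij => (hσN i).2.2 _ le_rfl _ (hσ.monotone hij)
  have hex := fun i : ℕ => exists_centered_arc hhyp hlength hh (p := u (σ i)) (q := v (σ i))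
    (ω := ω) (hT i)
    (by linarith [hσM i, hGu i i le_rfl, gromovProd_le_dist_left (u (σ i)) (u (σ i)) ω])
    (by linarith [hσM i, hGv i i le_rfl, gromovProd_le_dist_left (v (σ i)) (v (σ i)) ω])
  choose β hβvar hβinj hβshort hβ using hex
  have hxu : Tendsto (fun i => gromovProd (β i (-(i + 1))) (u (σ i)) ω) atTop atTop := by
    refine tendsto_atTop_mono (fun i : ℕ => ?_)
      ((tendsto_natCast_atTop_atTop.atTop_add (tendsto_const_nhds (x := 1 - h))).atTop_div_const
        (zero_lt_two' ℝ))
    have h1 := (hβ i (-(i + 1)) ⟨le_rfl, by linarith [hT i]⟩).1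
    have h2 := gromovProd_nonneg (u (σ i)) (v (σ i)) ω
    have h3 : 0 ≤ dist (β i (-(i + 1))) ω := dist_nonneg
    rw [gromovProd]
    linarith
  have hyv : Tendsto (fun i => gromovProd (β i (i + 1)) (v (σ i)) ω) atTop atTop := by
    refine tendsto_atTop_mono (fun i : ℕ => ?_)
      ((tendsto_natCast_atTop_atTop.atTop_add (tendsto_const_nhds (x := 1 - h))).atTop_div_const
        (zero_lt_two' ℝ))
    have h1 := (hβ i (i + 1) ⟨by linarith [hT i], le_rfl⟩).2.1
    have h2 := gromovProd_nonneg (u (σ i)) (v (σ i)) ω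
    have h3 : 0 ≤ dist (β i (i + 1)) ω := dist_nonneg
    rw [gromovProd]
    linarith
  obtain ⟨hx1, hx2⟩ := gromov_equivalent_of_subseq hδ hhyp hu hσ.tendsto_atTop hxu
  obtain ⟨hy1, hy2⟩ := gromov_equivalent_of_subseq hδ hhyp hv hσ.tendsto_atTop hyv
  have hvar : ∀ (i : ℕ) (a b : ℝ), a ∈ Icc (0 : ℝ) 1 → b ∈ Icc (0 : ℝ) 1 → a ≤ b →
      eVariationOn (fun s => β i ((2 * s - 1) * (i + 1))) (Icc a b) =
        ENNReal.ofReal ((2 * b - 1) * (i + 1) - (2 * a - 1) * (i + 1)) := by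
    intro i a b ha hb hab
    have hpos : (0 : ℝ) < 2 * (i + 1) := by linarith [hT i]
    have hcoord : ∀ s : ℝ, (2 * s - 1) * ((i : ℝ) + 1) = 2 * (i + 1) * s + -(i + 1) :=
      fun s => by ring
    rw [← hβvar i _ _ (coord_mem ha).1 (by have := hT i; gcongr) (coord_mem hb).2]
    simp only [hcoord]
    exact eVariationOn_comp_affine (β i) hpos _ a b
  have hdist : ∀ i : ℕ, ∀ a ∈ Icc (0 : ℝ) 1, ∀ b ∈ Icc (0 : ℝ) 1,
      dist (β i ((2 * a - 1) * (i + 1))) (β i ((2 * b - 1) * (i + 1))) ≤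
        2 * (i + 1) * dist a b := by
    intro i a ha b hb
    wlog hab : a ≤ b generalizing a b
    · rw [dist_comm, dist_comm a]
      exact this b hb a ha (le_of_not_ge hab)
    have h1 := eVariationOn.edist_le (fun s => β i ((2 * s - 1) * (i + 1)))
      (left_mem_Icc.2 hab) (right_mem_Icc.2 hab)
    rw [hvar i a b ha hb hab, edist_dist] at h1
    have h2 := (ENNReal.ofReal_le_ofReal_iff (by nlinarith [hT i])).1 h1
    rw [Real.dist_eq a, abs_sub_comm, abs_of_nonneg (sub_nonneg.2 hab)]
    linarith
  refine ⟨fun i s => β i ((2 * s - 1) * (i + 1)), fun i => β i (-(i + 1)), fun i => β i (i + 1),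
    centeredShift, ?_, hx1, hx2, hy1, hy2, ?_, ⟨0, by simp, ?_, ?_⟩, ?_, ?_, ?_, ?_⟩
  · refine fun i => ⟨?_, ?_, ?_, ?_⟩
    · refine (LipschitzOnWith.of_dist_le_mul (K := (2 * (i + 1) : ℝ).toNNReal)
        fun a ha b hb => ?_).continuousOn
      rw [Real.coe_toNNReal _ (by linarith [hT i])]
      exact hdist i a ha b hb
    · intro a ha b hb hab
      have h1 := hβinj i (coord_mem ha) (coord_mem hb) hab
      have := mul_right_cancel₀ (hT i).ne' h1
      linarith
    · simp only
      congr 1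
      ring
    · simp only
      congr 1
      ring
  · intro i
    rw [hvar i 0 1 (by simp) (by simp) zero_le_one]
    refine ENNReal.ofReal_le_ofReal ?_
    have := hβshort i
    linarith
  · exact tendsto_dist_atTop_of_gromovProd hxu _
  · exact tendsto_dist_atTop_of_gromovProd hyv _
  · refine fun i j hij => ⟨fun s hs => centeredShift_mem hij hs,
      (centeredShift_mono i j).monotoneOn _, fun a b ha hb hab => ?_⟩
    rw [hvar i a b ha hb hab, hvar j _ _ (centeredShift_mem hij ha) (centeredShift_mem hij hb)
      (centeredShift_mono i j hab), centeredShift_coord, centeredShift_coord]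
  · exact fun i s _ => (eq_centeredShift_iff.2 rfl).symm
  · intro i j m _ _ s _
    rw [eq_comm, eq_centeredShift_iff, centeredShift_coord, centeredShift_coord]
  · intro i j hij s hs
    simp only [centeredShift_coord]
    have ht := coord_mem (i := i) hs
    set t := (2 * s - 1) * ((i : ℝ) + 1)
    have hij' : (i : ℝ) ≤ j := by exact_mod_cast hij
    obtain ⟨h1, h2, h3⟩ := hβ i t ht
    obtain ⟨h4, h5, h6⟩ := hβ j t ⟨by linarith [ht.1], by linarith [ht.2]⟩
    have hee := he _ (hσN i).1 _ (hσN j).1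
    have hM' := hσM i
    rw [dist_comm]
    have key : dist (β i t) (β j t) ≤ 8 * δ + 2 * h := by
      rcases le_total 0 t with h0 | h0
      · rw [abs_of_nonneg h0] at h3 h6
        exact dist_le_of_fellow_travel hhyp h3 h2 h6 h5 hee (by linarith [hGv i j hij, ht.2])
      · rw [abs_of_nonpos h0] at h3 h6
        exact dist_le_of_fellow_travel hhyp (t := -t) (w := u (σ i)) (w' := u (σ j)) h3
          (by linarith) h6 (by linarith) hee (by linarith [hGu i j hij, ht.1])
    linarith
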